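/- Sequential estimation of average treatment effect: In the Neyman–Rubin potential outcomes model, suppose the fixed potential outcomes satisfy Y_t(k) ∈ [0,1] for all t ≥ 1, k ∈ {0,1}, predictions Ŷ_t(k) are F_{t−1}-measurable with Ŷ_t(k) ∈ [0,1], treatments Z_t ∈ {0,1} are adapted with P_t := E[Z_t | F_{t−1}] ∈ [p_min, 1 − p_min] a.s. for some 0 < p_min ≤ 1/2, and Y_t^obs := Y_t(Z_t). Let X_t := Ŷ_t(1) − Ŷ_t(0) + ((Z_t − P_t)/(P_t(1 − P_t)))(Y_t^obs − Ŷ_t(Z_t)), X̄_t := t^{−1} Σ_{i=1}^t X_i, ATE_t := t^{−1} Σ_{i=1}^t (Y_i(1) − Y_i(0)), and V_t := Σ_{i=1}^t ((Z_i − P_i)/(P_i(1 − P_i)))² (Y_i^obs − Ŷ_i(Z_i))². If u is any 1-sub-ψ_{E,c} uniform boundary with crossing probability α for scale c = 2/p_min, then P( ∀ t ≥ 1 : |X̄_t − ATE_t| < u(V_t)/t ) ≥ 1 − 2α. -/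

import Mathlib

open MeasureTheory ProbabilityTheory Filter Set

noncomputable section

/-- `S` is an `l0`-sub-ψ process with variance process `V`, where ψ has domain `D`. -/
def IsSubPsi {Ω : Type*} {mΩ : MeasurableSpace Ω} (P : Measure Ω)
    (F : Filtration ℕ mΩ) (D : Set ℝ) (ψ : ℝ → ℝ) (l0 : ℝ)
    (S V : ℕ → Ω → ℝ) : Prop :=
  Adapted F S ∧ Adapted F V ∧
    (∀ ω, S 0 ω = 0) ∧ (∀ ω, V 0 ω = 0) ∧ (∀ t ω, 0 ≤ V t ω) ∧
    ∀ l ∈ D, ∃ L : ℕ → Ω → ℝ,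
      Supermartingale L F P ∧ (∀ t ω, 0 ≤ L t ω) ∧
      (∫ ω, L 0 ω ∂P) ≤ l0 ∧
      ∀ t : ℕ, ∀ᵐ ω ∂P, Real.exp (l * S t ω - ψ l * V t ω) ≤ L t ω

/-- `u` is an `l0`-sub-ψ uniform boundary with crossing probability `α`. -/
def IsUniformBoundary (D : Set ℝ) (ψ : ℝ → ℝ) (l0 α : ℝ) (u : ℝ → ℝ) : Prop :=
  ∀ (Ω : Type) (mΩ : MeasurableSpace Ω) (P : Measure Ω),
    IsProbabilityMeasure P →
    ∀ (F : Filtration ℕ mΩ) (S V : ℕ → Ω → ℝ),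
      IsSubPsi P F D ψ l0 S V →
      P {ω | ∃ t : ℕ, 1 ≤ t ∧ u (V t ω) ≤ S t ω} ≤ ENNReal.ofReal α

/-- ψ_{E,c}(λ) = c⁻²(−log(1 − cλ) − cλ), the sub-exponential ψ function. -/
def psiE (c l : ℝ) : ℝ := (-Real.log (1 - c * l) - c * l) / c ^ 2

theorem sub_sq_mul_le_log_one_add {l x : ℝ} (hl : 0 ≤ l) (hl1 : l < 1) (hx : -1 ≤ x) :
    l * x - (-Real.log (1 - l) - l) * x ^ 2 ≤ Real.log (1 + l * x) := by
  have hpos : ∀ y ∈ Set.Ico (0 : ℝ) 1, 0 < 1 + y * x := fun y hy => by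
    nlinarith [hy.1, hy.2]
  have hder : ∀ y ∈ Set.Ico (0 : ℝ) 1, HasDerivAt
      (fun y => Real.log (1 + y * x) - (y * x - (-Real.log (1 - y) - y) * x ^ 2))
      (x / (1 + y * x) - (x - (-(-1 / (1 - y)) - 1) * x ^ 2)) y := by
    intro y hy
    have h1 : HasDerivAt (fun y : ℝ => 1 + y * x) x y := by
      simpa using ((hasDerivAt_id y).mul_const x).const_add 1
    have h2 : HasDerivAt (fun y : ℝ => y * x) x y := by
      simpa using (hasDerivAt_id y).mul_const x
    have h3 : HasDerivAt (fun y : ℝ => 1 - y) (-1) y := by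
      simpa using (hasDerivAt_id y).const_sub 1
    exact (h1.log (hpos y hy).ne').sub
      (h2.sub (((h3.log (sub_pos.2 hy.2).ne').neg.sub (hasDerivAt_id y)).mul_const (x ^ 2)))
  have hmono := monotoneOn_of_deriv_nonneg (convex_Ico (0 : ℝ) 1)
    (fun y hy => (hder y hy).continuousAt.continuousWithinAt)
    (fun y hy => (hder y (interior_subset hy)).differentiableAt.differentiableWithinAt)
    (fun y hy => by
      have hy' := interior_subset hy
      rw [(hder y hy').deriv]
      have h1 := hpos y hy'
      have h2 : 0 < 1 - y := sub_pos.2 hy'.2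
      have : x / (1 + y * x) - (x - (-(-1 / (1 - y)) - 1) * x ^ 2)
          = y ^ 2 * x ^ 2 * (1 + x) / ((1 + y * x) * (1 - y)) := by
        have h1' : 1 + x * y ≠ 0 := by rw [mul_comm]; exact h1.ne'
        field_simp
        ring
      rw [this]
      have h3 : 0 ≤ 1 + x := by linarith
      positivity)
  have := hmono (Set.left_mem_Ico.2 one_pos) ⟨hl, hl1⟩ hl
  simpa using this

theorem psiE_nonneg {c l : ℝ} (hcl : c * l < 1) : 0 ≤ psiE c l := by
  have := Real.log_le_sub_one_of_pos (sub_pos.2 hcl)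
  exact div_nonneg (by linarith) (sq_nonneg c)

theorem exp_sub_psiE_mul_sq_le {c l x : ℝ} (hc : 0 < c) (hl : 0 ≤ l) (hcl : c * l < 1)
    (hx : -c ≤ x) : Real.exp (l * x - psiE c l * x ^ 2) ≤ 1 + l * x := by
  have hx' : -1 ≤ x / c := by rw [le_div_iff₀ hc]; linarith
  have h := sub_sq_mul_le_log_one_add (mul_nonneg hc.le hl) hcl hx'
  have e1 : c * l * (x / c) = l * x := by field_simp
  have e2 : (-Real.log (1 - c * l) - c * l) * (x / c) ^ 2 = psiE c l * x ^ 2 := by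
    unfold psiE; field_simp
  rw [e1, e2] at h
  have hpos : 0 < 1 + l * x := by nlinarith
  exact (Real.le_log_iff_exp_le hpos).1 h

/-- A process on the target space whose pullback is a supermartingale is a supermartingale
for the image measure. -/
theorem supermartingale_map {Ω Ω' : Type*} {mΩ : MeasurableSpace Ω} {mΩ' : MeasurableSpace Ω'}
    {P : Measure Ω} [IsProbabilityMeasure P] {F : Filtration ℕ mΩ} {G : Filtration ℕ mΩ'}
    {φ : Ω → Ω'} (hφ : Measurable φ) (hφt : ∀ t, Measurable[F t, G t] φ)
    {L : ℕ → Ω' → ℝ} (hL : StronglyAdapted G L)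
    (h : Supermartingale (fun t ω => L t (φ ω)) F P) :
    Supermartingale L G (P.map φ) := by
  have : IsProbabilityMeasure (P.map φ) := Measure.isProbabilityMeasure_map hφ.aemeasurable
  have hm : ∀ t, AEStronglyMeasurable (L t) (P.map φ) := fun t =>
    ((hL t).mono (G.le t)).aestronglyMeasurable
  refine supermartingale_of_setIntegral_succ_le hL
    (fun t => (integrable_map_measure (hm t) hφ.aemeasurable).2 (h.2.2 t)) fun t s hs => ?_
  rw [setIntegral_map (G.le t s hs) (hm _) hφ.aemeasurable,
    setIntegral_map (G.le t s hs) (hm _) hφ.aemeasurable]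
  exact h.setIntegral_le t.le_succ (hφt t hs)

section Increments

variable {Ω : Type*} {mΩ : MeasurableSpace Ω} {P : Measure Ω} [IsProbabilityMeasure P]
  {F : Filtration ℕ mΩ} {c : ℝ} {w m : ℕ → Ω → ℝ}

theorem supermartingale_exp_sub_psiE (hc : 0 < c)
    (hw : ∀ t, Measurable[F (t + 1)] (w t)) (hm : ∀ t, Measurable[F t] (m t))
    (hwc : ∀ t, ∀ᵐ ω ∂P, |w t ω| ≤ c) (hwm : ∀ t, P[w t | F t] =ᵐ[P] m t)
    {l : ℝ} (hl : 0 ≤ l) (hcl : c * l < 1) :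
    Supermartingale (fun t ω => Real.exp
      (l * ∑ i ∈ Finset.range t, (w i ω - m i ω)
        - psiE c l * ∑ i ∈ Finset.range t, w i ω ^ 2)) F P := by
  have hψ := psiE_nonneg hcl
  set E : ℕ → Ω → ℝ := fun t ω => Real.exp
      (l * ∑ i ∈ Finset.range t, (w i ω - m i ω)
        - psiE c l * ∑ i ∈ Finset.range t, w i ω ^ 2) with hE
  have hmc : ∀ t, ∀ᵐ ω ∂P, |m t ω| ≤ c := fun t => by
    have := ae_bdd_abs_condExp_of_ae_bdd_abs (m := F t) (hwc t)
    filter_upwards [this, hwm t] with ω h1 h2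
    rw [← h2]; exact h1
  have hEm : ∀ t, Measurable[F t] (E t) := fun t => by
    have hwt : ∀ i ∈ Finset.range t, Measurable[F t] (w i) := fun i hi =>
      (hw i).mono (F.mono (Finset.mem_range.1 hi)) le_rfl
    have hmt : ∀ i ∈ Finset.range t, Measurable[F t] (m i) := fun i hi =>
      (hm i).mono (F.mono (Finset.mem_range.1 hi).le) le_rfl
    refine Real.measurable_exp.comp (Measurable.sub ?_ ?_)
    · exact (Finset.measurable_fun_sum _ fun i hi => (hwt i hi).sub (hmt i hi)).const_mul l
    · exact (Finset.measurable_fun_sum _ fun i hi => (hwt i hi).pow_const 2).const_mul _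
  have hEb : ∀ t, ∀ᵐ ω ∂P, E t ω ≤ Real.exp (l * (t * (2 * c))) := fun t => by
    filter_upwards [ae_all_iff.2 hwc, ae_all_iff.2 hmc] with ω h1 h2
    refine Real.exp_le_exp.2 ?_
    have hS : ∑ i ∈ Finset.range t, (w i ω - m i ω) ≤ t * (2 * c) := by
      have := Finset.sum_le_card_nsmul (Finset.range t) (fun i => w i ω - m i ω) (2 * c)
        (fun i _ => by linarith [(abs_le.1 (h1 i)).2, (abs_le.1 (h2 i)).1])
      simpa using this
    have hV : 0 ≤ ∑ i ∈ Finset.range t, w i ω ^ 2 := Finset.sum_nonneg fun i _ => sq_nonneg _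
    nlinarith [mul_le_mul_of_nonneg_left hS hl, mul_nonneg hψ hV]
  have hEi : ∀ t, Integrable (E t) P := fun t =>
    Integrable.of_bound ((hEm t).mono (F.le t) le_rfl).aestronglyMeasurable _ <| by
      filter_upwards [hEb t] with ω h
      rwa [Real.norm_eq_abs, abs_of_pos (Real.exp_pos _)]
  refine supermartingale_nat (fun t => (hEm t).stronglyMeasurable) hEi fun t => ?_
  have hwi : Integrable (w t) P :=
    Integrable.of_bound ((hw t).mono (F.le _) le_rfl).aestronglyMeasurable c (hwc t)
  set A : Ω → ℝ := fun ω => E t ω * Real.exp (-(l * m t ω)) with hA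
  have hAm : Measurable[F t] A :=
    (hEm t).mul (Real.measurable_exp.comp ((hm t).const_mul l).neg)
  have hAb : ∀ᵐ ω ∂P, ‖A ω‖ ≤ Real.exp (l * (t * (2 * c))) * Real.exp (l * c) := by
    filter_upwards [hEb t, hmc t] with ω h1 h2
    rw [Real.norm_eq_abs, abs_of_pos (by positivity)]
    refine mul_le_mul h1 (Real.exp_le_exp.2 ?_) (Real.exp_pos _).le (Real.exp_pos _).le
    nlinarith [(abs_le.1 h2).1]
  have hgi : Integrable (fun ω => 1 + l * w t ω) P :=
    (integrable_const 1).add (hwi.const_mul l)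
  have hstep : E (t + 1) ≤ᵐ[P] A * fun ω => 1 + l * w t ω := by
    filter_upwards [hwc t] with ω h
    have := exp_sub_psiE_mul_sq_le hc hl hcl (abs_le.1 h).1
    calc E (t + 1) ω = A ω * Real.exp (l * w t ω - psiE c l * w t ω ^ 2) := by
          simp only [hA, hE, ← Real.exp_add, Finset.sum_range_succ]
          ring_nf
      _ ≤ A ω * (1 + l * w t ω) := by
          refine mul_le_mul_of_nonneg_left this ?_
          positivity
  have hgc : P[fun ω => 1 + l * w t ω | F t] =ᵐ[P] fun ω => 1 + l * m t ω := by
    have h1 := condExp_add (μ := P) (integrable_const (1 : ℝ)) (hwi.const_mul l) (F t)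
    have h2 := condExp_smul (μ := P) l (w t) (F t)
    have h3 := condExp_const (μ := P) (F.le t) (1 : ℝ)
    filter_upwards [h1, h2, hwm t] with ω h1 h2 h4
    calc _ = _ := h1
      _ = 1 + l * m t ω := by
        rw [Pi.add_apply, h3]
        congr 1
        rw [← h4]
        exact h2
  have hAg : Integrable (A * fun ω => 1 + l * w t ω) P :=
    hgi.bdd_mul (hAm.mono (F.le t) le_rfl).aestronglyMeasurable hAb
  have hpull := condExp_mul_of_stronglyMeasurable_left hAm.stronglyMeasurable hAg hgi
  filter_upwards [condExp_mono (m := F t) (hEi (t + 1)) hAg hstep, hpull, hgc] with ω h1 h2 h3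
  refine h1.trans ?_
  rw [h2, Pi.mul_apply, h3]
  have h4 : 1 + l * m t ω ≤ Real.exp (l * m t ω) := by
    linarith [Real.add_one_le_exp (l * m t ω)]
  calc A ω * (1 + l * m t ω) ≤ A ω * Real.exp (l * m t ω) := by
        refine mul_le_mul_of_nonneg_left h4 ?_
        positivity
    _ = E t ω := by
        simp only [hA, mul_assoc, ← Real.exp_add]
        simp

/-- The filtration on sequence space in which time `t` sees the first `t` coordinates. -/
def prefixFiltration (β : Type*) [mβ : MeasurableSpace β] :
    Filtration ℕ (MeasurableSpace.pi : MeasurableSpace (ℕ → β)) where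
  seq t := ⨆ i : Fin t, mβ.comap fun x : ℕ → β => x i
  mono' _ _ hst := iSup_le fun i =>
    le_iSup (fun i : Fin _ => mβ.comap fun x : ℕ → β => x i) (Fin.castLE hst i)
  le' _ := iSup_le fun i => (measurable_pi_apply (i : ℕ)).comap_le

theorem measurable_prefixFiltration {β : Type*} [mβ : MeasurableSpace β] {i t : ℕ} (h : i < t) :
    Measurable[prefixFiltration β t] (fun x : ℕ → β => x i) :=
  measurable_iff_comap_le.2 <|
    le_iSup (fun i : Fin t => mβ.comap fun x : ℕ → β => x i) ⟨i, h⟩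

/-- A sub-exponential uniform boundary bounds the sum of bounded increments `w` centered at
their conditional means `m`, with variance process the sum of the `w ^ 2`. -/
theorem IsUniformBoundary.measure_crossing_le (hc : 0 < c)
    (hw : ∀ t, Measurable[F (t + 1)] (w t)) (hm : ∀ t, Measurable[F t] (m t))
    (hwc : ∀ t, ∀ᵐ ω ∂P, |w t ω| ≤ c) (hwm : ∀ t, P[w t | F t] =ᵐ[P] m t)
    {D : Set ℝ} (hD : ∀ l ∈ D, 0 ≤ l ∧ c * l < 1) {α : ℝ} {u : ℝ → ℝ}
    (hu : IsUniformBoundary D (psiE c) 1 α u) :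
    P {ω | ∃ t : ℕ, 1 ≤ t ∧ u (∑ i ∈ Finset.range t, w i ω ^ 2)
      ≤ ∑ i ∈ Finset.range t, (w i ω - m i ω)} ≤ ENNReal.ofReal α := by
  let φ : Ω → ℕ → ℝ × ℝ := fun ω i => (w i ω, m i ω)
  have hpair : ∀ i t, i < t → Measurable[F t] fun ω => (w i ω, m i ω) := fun i t hit =>
    ((hw i).mono (F.mono hit) le_rfl).prodMk ((hm i).mono (F.mono hit.le) le_rfl)
  have hφ : Measurable φ := measurable_pi_lambda _ fun i =>
    (hpair i (i + 1) i.lt_succ_self).mono (F.le _) le_rfl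
  have hφt : ∀ t, Measurable[F t, prefixFiltration (ℝ × ℝ) t] φ := fun t => by
    refine measurable_iff_comap_le.2 ?_
    change MeasurableSpace.comap φ (⨆ i : Fin t, _) ≤ _
    rw [MeasurableSpace.comap_iSup]
    refine iSup_le fun i => ?_
    rw [MeasurableSpace.comap_comp]
    exact (hpair i t i.2).comap_le
  let S : ℕ → (ℕ → ℝ × ℝ) → ℝ := fun t x => ∑ i ∈ Finset.range t, ((x i).1 - (x i).2)
  let V : ℕ → (ℕ → ℝ × ℝ) → ℝ := fun t x => ∑ i ∈ Finset.range t, (x i).1 ^ 2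
  have hx : ∀ t, ∀ i ∈ Finset.range t,
      Measurable[prefixFiltration (ℝ × ℝ) t] fun x : ℕ → ℝ × ℝ => x i := fun t i hi =>
    measurable_prefixFiltration (Finset.mem_range.1 hi)
  have hS : Adapted (prefixFiltration (ℝ × ℝ)) S := fun t =>
    Finset.measurable_fun_sum _ fun i hi => (hx t i hi).fst.sub (hx t i hi).snd
  have hV : Adapted (prefixFiltration (ℝ × ℝ)) V := fun t =>
    Finset.measurable_fun_sum _ fun i hi => (hx t i hi).fst.pow_const 2
  have hprob : IsProbabilityMeasure (P.map φ) := Measure.isProbabilityMeasure_map hφ.aemeasurable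
  have hsub : IsSubPsi (P.map φ) (prefixFiltration (ℝ × ℝ)) D (psiE c) 1 S V := by
    refine ⟨hS, hV, fun x => by simp [S], fun x => by simp [V],
      fun t x => Finset.sum_nonneg fun i _ => sq_nonneg _, fun l hl => ?_⟩
    refine ⟨fun t x => Real.exp (l * S t x - psiE c l * V t x), ?_,
      fun t x => (Real.exp_pos _).le, by simp [S, V], fun t => ae_of_all _ fun x => le_rfl⟩
    refine supermartingale_map hφ hφt (fun t => Measurable.stronglyMeasurable ?_)
      (supermartingale_exp_sub_psiE hc hw hm hwc hwm (hD l hl).1 (hD l hl).2)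
    exact Real.measurable_exp.comp (((hS t).const_mul l).sub ((hV t).const_mul _))
  exact (Measure.le_map_apply hφ.aemeasurable _).trans (hu _ _ _ hprob _ _ _ hsub)

end Increments

/-- The inverse-probability-weighted residual for assignment `z` with treatment probability `p`,
outcomes `y0`, `y1` and predictions `h0`, `h1`. -/
def ipwResidual (z p y0 y1 h0 h1 : ℝ) : ℝ :=
  ((z - p) / (p * (1 - p))) * ((if z = 1 then y1 else y0) - (if z = 1 then h1 else h0))

theorem ipwResidual_eq {z p : ℝ} (hz : z = 0 ∨ z = 1) (hp : 0 < p) (hp1 : p < 1)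
    (y0 y1 h0 h1 : ℝ) :
    ipwResidual z p y0 y1 h0 h1
      = ((y1 - h1) / p + (y0 - h0) / (1 - p)) * z - (y0 - h0) / (1 - p) := by
  have h2 : 1 - p ≠ 0 := (sub_pos.2 hp1).ne'
  rcases hz with rfl | rfl
  · simp only [ipwResidual, zero_ne_one, if_false]
    field_simp
    ring
  · simp only [ipwResidual, if_true]
    field_simp
    ring

theorem abs_div_le_inv {a p q : ℝ} (ha : |a| ≤ 1) (hq : 0 < q) (hqp : q ≤ p) :
    |a / p| ≤ q⁻¹ := by
  have hp := hq.trans_le hqp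
  rw [abs_div, abs_of_pos hp, ← one_div]
  exact div_le_div₀ zero_le_one ha hq hqp

theorem abs_ipwResidual_le {z p q y0 y1 h0 h1 : ℝ} (hz : z = 0 ∨ z = 1) (hq : 0 < q)
    (hp : p ∈ Set.Icc q (1 - q)) (hr0 : |y0 - h0| ≤ 1) (hr1 : |y1 - h1| ≤ 1) :
    |ipwResidual z p y0 y1 h0 h1| ≤ q⁻¹ := by
  rw [ipwResidual_eq hz (hq.trans_le hp.1) (by linarith [hp.2])]
  rcases hz with rfl | rfl
  · simpa using abs_div_le_inv hr0 hq (by linarith [hp.2] : q ≤ 1 - p)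
  · simpa using abs_div_le_inv hr1 hq hp.1

theorem measurable_ipwResidual {Ω : Type*} {mΩ : MeasurableSpace Ω} {Z p h0 h1 : Ω → ℝ}
    (hZ : Measurable Z) (hp : Measurable p) (hh0 : Measurable h0) (hh1 : Measurable h1)
    (y0 y1 : ℝ) : Measurable fun ω => ipwResidual (Z ω) (p ω) y0 y1 (h0 ω) (h1 ω) := by
  have hset : MeasurableSet {ω | Z ω = 1} := hZ (measurableSet_singleton 1)
  exact ((hZ.sub hp).div (hp.mul (hp.const_sub 1))).mul
    ((Measurable.ite hset measurable_const measurable_const).sub (Measurable.ite hset hh1 hh0))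

theorem condExp_ipwResidual {Ω : Type*} {m mΩ : MeasurableSpace Ω} (hm : m ≤ mΩ)
    {P : Measure Ω} [IsProbabilityMeasure P] {Z h0 h1 : Ω → ℝ}
    (hZint : Integrable Z P) (hZ : ∀ ω, Z ω = 0 ∨ Z ω = 1)
    (hh0 : Measurable[m] h0) (hh1 : Measurable[m] h1) {y0 y1 q : ℝ} (hq : 0 < q)
    (hp : ∀ᵐ ω ∂P, (P[Z | m]) ω ∈ Set.Icc q (1 - q))
    (hr0 : ∀ ω, |y0 - h0 ω| ≤ 1) (hr1 : ∀ ω, |y1 - h1 ω| ≤ 1) :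
    P[fun ω => ipwResidual (Z ω) ((P[Z | m]) ω) y0 y1 (h0 ω) (h1 ω) | m]
      =ᵐ[P] fun ω => (y1 - h1 ω) - (y0 - h0 ω) := by
  have hpm : Measurable[m] (P[Z | m]) := stronglyMeasurable_condExp.measurable
  set B : Ω → ℝ := fun ω => (y0 - h0 ω) / (1 - (P[Z | m]) ω) with hB
  set A : Ω → ℝ := fun ω => (y1 - h1 ω) / (P[Z | m]) ω + B ω with hA
  have hBm : Measurable[m] B := (hh0.const_sub y0).div (hpm.const_sub 1)
  have hAm : Measurable[m] A := ((hh1.const_sub y1).div hpm).add hBm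
  have hBb : ∀ᵐ ω ∂P, ‖B ω‖ ≤ q⁻¹ := by
    filter_upwards [hp] with ω h
    exact abs_div_le_inv (hr0 ω) hq (by linarith [h.2])
  have hAb : ∀ᵐ ω ∂P, ‖A ω‖ ≤ q⁻¹ + q⁻¹ := by
    filter_upwards [hp, hBb] with ω h h'
    exact (norm_add_le _ _).trans (add_le_add (abs_div_le_inv (hr1 ω) hq h.1) h')
  have hBi : Integrable B P := .of_bound (hBm.mono hm le_rfl).aestronglyMeasurable _ hBb
  have hAZ : Integrable (A * Z) P := hZint.bdd_mul (hAm.mono hm le_rfl).aestronglyMeasurable hAb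
  have heq : (fun ω => ipwResidual (Z ω) ((P[Z | m]) ω) y0 y1 (h0 ω) (h1 ω))
      =ᵐ[P] A * Z - B := by
    filter_upwards [hp] with ω h
    exact ipwResidual_eq (hZ ω) (hq.trans_le h.1) (by linarith [h.2]) ..
  filter_upwards [condExp_congr_ae (m := m) heq, condExp_sub hAZ hBi m,
    condExp_mul_of_stronglyMeasurable_left hAm.stronglyMeasurable hAZ hZint, hp] with ω e1 e2 e3 h
  rw [e1, e2, Pi.sub_apply, e3, Pi.mul_apply,
    condExp_of_stronglyMeasurable hm hBm.stronglyMeasurable hBi]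
  have hp0 : (P[Z | m]) ω ≠ 0 := (hq.trans_le h.1).ne'
  have hp1 : 1 - (P[Z | m]) ω ≠ 0 := by
    have := h.2
    intro h0
    linarith
  simp only [hA, hB]
  field_simp
  ring

/-- Corollary 2 (confidence sequence for the sample average treatment effect in the
Neyman–Rubin model, under sequentially randomized treatment assignment): with the
inverse-probability-weighted estimator `X_t` and the empirical variance process `V_t`,
any sub-exponential uniform boundary `u` with crossing probability `α` for scale
`2/p_min` yields `P(∀ t ≥ 1 : |X̄_t − ATE_t| < u(V_t)/t) ≥ 1 − 2α`. -/
theorem ate_confidence_sequence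
    {Ω : Type*} {mΩ : MeasurableSpace Ω} (P : Measure Ω) [IsProbabilityMeasure P]
    (F : Filtration ℕ mΩ)
    -- fixed potential outcomes in [0,1]
    (Y0 Y1 : ℕ → ℝ)
    (hY0 : ∀ t, Y0 t ∈ Set.Icc (0 : ℝ) 1) (hY1 : ∀ t, Y1 t ∈ Set.Icc (0 : ℝ) 1)
    -- predictable predictions in [0,1]
    (Yhat0 Yhat1 : ℕ → Ω → ℝ)
    (hYhat0m : ∀ t : ℕ, StronglyMeasurable[F t] (Yhat0 (t + 1)))
    (hYhat1m : ∀ t : ℕ, StronglyMeasurable[F t] (Yhat1 (t + 1)))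
    (hYhat0b : ∀ t ω, Yhat0 t ω ∈ Set.Icc (0 : ℝ) 1)
    (hYhat1b : ∀ t ω, Yhat1 t ω ∈ Set.Icc (0 : ℝ) 1)
    -- adapted {0,1}-valued treatment assignments
    (Z : ℕ → Ω → ℝ) (hZadp : Adapted F Z) (hZint : ∀ t, Integrable (Z t) P)
    (hZ01 : ∀ t ω, Z t ω = 0 ∨ Z t ω = 1)
    -- treatment probabilities bounded away from 0 and 1
    (pmin : ℝ) (hpmin : 0 < pmin) (hpmin2 : pmin ≤ 1 / 2)
    (hPt : ∀ t : ℕ, 1 ≤ t →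
      ∀ᵐ ω ∂P, (P[Z t|F (t - 1)]) ω ∈ Set.Icc pmin (1 - pmin))
    (α : ℝ) (hα : α ∈ Set.Ioo (0 : ℝ) 1)
    (u : ℝ → ℝ)
    (hu : IsUniformBoundary {l : ℝ | 0 ≤ l ∧ l < pmin / 2} (psiE (2 / pmin)) 1 α u) :
    ENNReal.ofReal (1 - 2 * α) ≤
      P {ω | ∀ t : ℕ, 1 ≤ t →
        |(∑ i ∈ Finset.Icc 1 t,
              (Yhat1 i ω - Yhat0 i ω
                + ((Z i ω - (P[Z i|F (i - 1)]) ω)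
                      / ((P[Z i|F (i - 1)]) ω * (1 - (P[Z i|F (i - 1)]) ω)))
                  * ((if Z i ω = 1 then Y1 i else Y0 i)
                      - (if Z i ω = 1 then Yhat1 i ω else Yhat0 i ω)))) / (t : ℝ)
            - (∑ i ∈ Finset.Icc 1 t, (Y1 i - Y0 i)) / (t : ℝ)|
          < u (∑ i ∈ Finset.Icc 1 t,
                ((Z i ω - (P[Z i|F (i - 1)]) ω)
                      / ((P[Z i|F (i - 1)]) ω * (1 - (P[Z i|F (i - 1)]) ω))) ^ 2
                  * ((if Z i ω = 1 then Y1 i else Y0 i)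
                      - (if Z i ω = 1 then Yhat1 i ω else Yhat0 i ω)) ^ 2)
              / (t : ℝ)} := by
  have hres : ∀ {a b : ℝ}, a ∈ Set.Icc (0 : ℝ) 1 → b ∈ Set.Icc (0 : ℝ) 1 → |a - b| ≤ 1 :=
    fun ha hb => abs_le.2 ⟨by linarith [ha.1, hb.2], by linarith [ha.2, hb.1]⟩
  let w : ℕ → Ω → ℝ := fun t ω => ipwResidual (Z (t + 1) ω) ((P[Z (t + 1)|F t]) ω)
    (Y0 (t + 1)) (Y1 (t + 1)) (Yhat0 (t + 1) ω) (Yhat1 (t + 1) ω)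
  let m : ℕ → Ω → ℝ := fun t ω => (Y1 (t + 1) - Yhat1 (t + 1) ω) - (Y0 (t + 1) - Yhat0 (t + 1) ω)
  have hp : ∀ t, ∀ᵐ ω ∂P, (P[Z (t + 1)|F t]) ω ∈ Set.Icc pmin (1 - pmin) := fun t =>
    hPt (t + 1) (Nat.le_add_left 1 t)
  have hw : ∀ t, Measurable[F (t + 1)] (w t) := fun t =>
    have hle : F t ≤ F (t + 1) := F.mono t.le_succ
    measurable_ipwResidual (hZadp (t + 1)) (stronglyMeasurable_condExp.measurable.mono hle le_rfl)
      ((hYhat0m t).measurable.mono hle le_rfl) ((hYhat1m t).measurable.mono hle le_rfl) _ _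
  have hm : ∀ t, Measurable[F t] (m t) := fun t =>
    ((hYhat1m t).measurable.const_sub _).sub ((hYhat0m t).measurable.const_sub _)
  have hwc : ∀ t, ∀ᵐ ω ∂P, |w t ω| ≤ 2 / pmin := fun t => by
    filter_upwards [hp t] with ω h
    refine (abs_ipwResidual_le (hZ01 _ ω) hpmin h (hres (hY0 _) (hYhat0b _ ω))
      (hres (hY1 _) (hYhat1b _ ω))).trans ?_
    rw [← one_div]
    gcongr
    norm_num
  have hwm : ∀ t, P[w t|F t] =ᵐ[P] m t := fun t =>
    condExp_ipwResidual (F.le t) (hZint _) (hZ01 _) (hYhat0m t).measurable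
      (hYhat1m t).measurable hpmin (hp t) (fun ω => hres (hY0 _) (hYhat0b _ ω))
      (fun ω => hres (hY1 _) (hYhat1b _ ω))
  have hc : 0 < 2 / pmin := by positivity
  have hD : ∀ l ∈ {l : ℝ | 0 ≤ l ∧ l < pmin / 2}, 0 ≤ l ∧ 2 / pmin * l < 1 := fun l hl =>
    ⟨hl.1, by rw [div_mul_eq_mul_div, div_lt_one hpmin]; linarith [hl.2]⟩
  have hupper := hu.measure_crossing_le hc hw hm hwc hwm hD
  have hlower := hu.measure_crossing_le (w := fun t ω => -w t ω) (m := fun t ω => -m t ω) hc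
    (fun t => (hw t).neg) (fun t => (hm t).neg) (fun t => by simpa only [abs_neg] using hwc t)
    (fun t => (condExp_neg (w t) (F t)).trans (hwm t).neg) hD
  have hIcc : ∀ (f : ℕ → ℝ) (t : ℕ),
      ∑ i ∈ Finset.Icc 1 t, f i = ∑ i ∈ Finset.range t, f (i + 1) := fun f t => by
    rw [Finset.range_eq_Ico, Finset.sum_Ico_add' f 0 t 1, zero_add]
    rfl
  set good : Set Ω := _
  change _ ≤ P good
  have hcover : Set.univ ⊆ good ∪ ({ω | ∃ t : ℕ, 1 ≤ t ∧ u (∑ i ∈ Finset.range t, w i ω ^ 2)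
      ≤ ∑ i ∈ Finset.range t, (w i ω - m i ω)} ∪
      {ω | ∃ t : ℕ, 1 ≤ t ∧ u (∑ i ∈ Finset.range t, (-w i ω) ^ 2)
      ≤ ∑ i ∈ Finset.range t, (-w i ω - -m i ω)}) := by
    intro ω _
    by_contra hω
    simp only [Set.mem_union, Set.mem_ofPred_eq, not_or, not_exists, not_and, not_le] at hω
    obtain ⟨hgood, h1, h2⟩ := hω
    refine hgood fun t ht => ?_
    have ht0 : (0 : ℝ) < t := by exact_mod_cast ht
    rw [← sub_div, abs_div, abs_of_pos ht0, div_lt_div_iff_of_pos_right ht0,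
      ← Finset.sum_sub_distrib, hIcc, hIcc]
    have eV : ∀ i, ((Z (i + 1) ω - (P[Z (i + 1)|F i]) ω)
          / ((P[Z (i + 1)|F i]) ω * (1 - (P[Z (i + 1)|F i]) ω))) ^ 2
        * ((if Z (i + 1) ω = 1 then Y1 (i + 1) else Y0 (i + 1))
          - (if Z (i + 1) ω = 1 then Yhat1 (i + 1) ω else Yhat0 (i + 1) ω)) ^ 2
        = w i ω ^ 2 := fun i => (mul_pow _ _ 2).symm
    have eS : ∀ i, Yhat1 (i + 1) ω - Yhat0 (i + 1) ω + ((Z (i + 1) ω - (P[Z (i + 1)|F i]) ω)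
          / ((P[Z (i + 1)|F i]) ω * (1 - (P[Z (i + 1)|F i]) ω)))
        * ((if Z (i + 1) ω = 1 then Y1 (i + 1) else Y0 (i + 1))
          - (if Z (i + 1) ω = 1 then Yhat1 (i + 1) ω else Yhat0 (i + 1) ω))
        - (Y1 (i + 1) - Y0 (i + 1)) = w i ω - m i ω := fun i => by
      simp only [w, m, ipwResidual]
      ring
    simp only [Nat.add_sub_cancel, eV, eS]
    have h1 := h1 t ht
    have h2 := h2 t ht
    have eN : ∑ i ∈ Finset.range t, (-w i ω - -m i ω)
        = -∑ i ∈ Finset.range t, (w i ω - m i ω) := by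
      rw [← Finset.sum_neg_distrib]
      exact Finset.sum_congr rfl fun i _ => by ring
    simp only [neg_sq, eN] at h2
    exact abs_lt.2 ⟨by linarith, h1⟩
  have htotal : 1 ≤ P good + (ENNReal.ofReal α + ENNReal.ofReal α) :=
    calc 1 = P Set.univ := measure_univ.symm
      _ ≤ _ := measure_mono hcover
      _ ≤ _ := measure_union_le _ _
      _ ≤ _ := by gcongr; exact (measure_union_le _ _).trans (add_le_add hupper hlower)
  rw [ENNReal.ofReal_sub 1 (by linarith [hα.1]), ENNReal.ofReal_one, two_mul,
    ENNReal.ofReal_add hα.1.le hα.1.le]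
  exact tsub_le_iff_right.2 htotal
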